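/- arXiv:2511.15063 — 3 statements merged into one kernel-verified Lean document; each statement's English description precedes it below -/
import Mathlib

section
/- Let F act on a tree T with orientation o and base vertex v₀, and let δ : V → V be the Dehn twist map based at v₀ (so δ(v) = o(e₁)⋯o(e_k) • v where e₁,…,e_k are the oriented edges of the unique path from v₀ to v). Then δ preserves adjacency: for every pair of adjacent vertices v and v' of T, the vertices δ(v) and δ(v') are adjacent. In particular, δ extends to a simplicial automorphism of T. -/
/-- The product `o(e₁)⋯o(e_k)` of the orientation values over the consecutive
oriented edges (darts) of a walk `p`. -/
def walkProd {V F : Type*} [Group F] {G : SimpleGraph V} {u v : V}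
    (o : V → V → F) (p : G.Walk u v) : F :=
  (p.darts.map fun d => o d.toProd.1 d.toProd.2).prod

theorem walkProd_concat {V F : Type*} [Group F] {G : SimpleGraph V} {u v w : V}
    (o : V → V → F) (p : G.Walk u v) (h : G.Adj v w) :
    walkProd o (p.concat h) = walkProd o p * o v w := by
  simp [walkProd, SimpleGraph.Walk.darts_concat]

/-- Let `F` act on a tree `G` by graph automorphisms, with orientation `o` and
base vertex `v₀`, and let `δ` be the Dehn twist map based at `v₀`
(so `δ v = o(e₁)⋯o(e_k) • v` along the unique path from `v₀` to `v`).
Then `δ` preserves adjacency. -/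
theorem dehnTwist_preserves_adjacency
    {V F : Type*} [Group F] [MulAction F V]
    (G : SimpleGraph V) (hT : G.IsTree)
    (hact : ∀ (g : F) (u v : V), G.Adj u v ↔ G.Adj (g • u) (g • v))
    (o : V → V → F)
    (ho1 : ∀ u v, G.Adj u v → o v u = (o u v)⁻¹)
    (ho2 : ∀ (g : F) (u v : V), G.Adj u v → o (g • u) (g • v) = g * o u v * g⁻¹)
    (ho3 : ∀ u v, G.Adj u v →
      (Subgroup.zpowers (o u v) : Set F) = {g : F | g • u = u ∧ g • v = v})
    (v₀ : V) (δ : V → V)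
    (hδ : ∀ (v : V) (p : G.Walk v₀ v), p.IsPath → δ v = walkProd o p • v) :
    ∀ v v' : V, G.Adj v v' → G.Adj (δ v) (δ v') := by
  have extend : ∀ v v' (h : G.Adj v v') (p : G.Walk v₀ v), p.IsPath → v' ∉ p.support →
      G.Adj (δ v) (δ v') := by
    intro v v' h p hp hv'
    have hmem : o v v' ∈ {g : F | g • v = v ∧ g • v' = v'} := by
      rw [← ho3 v v' h]
      exact Subgroup.mem_zpowers _
    rw [hδ v p hp, hδ v' (p.concat h) (hp.concat hv' h), walkProd_concat, mul_smul, hmem.2]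
    exact (hact _ _ _).mp h
  intro v v' h
  obtain ⟨p, hp, -⟩ := hT.existsUnique_path v₀ v
  classical
  by_cases hv' : v' ∈ p.support
  · exact (extend v' v h.symm (p.takeUntil v' hv') (hp.takeUntil hv')
      (SimpleGraph.Walk.endpoint_notMem_support_takeUntil hp hv' h.ne)).symm
  · exact extend v v' h p hp hv'
end

section
/- Let F act on a tree T with orientation o and base vertex v₀, and let δ : V → V be the Dehn twist map based at v₀. Define δ' : V → V by δ'(v) = o(e₁)⁻¹⋯o(e_k)⁻¹ • v, where e₁,…,e_k are the oriented edges of the unique path from v₀ to v. Then δ' is a two-sided inverse of δ: δ(δ'(v)) = v and δ'(δ(v)) = v for every vertex v ∈ V. -/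
/-- The product `o(e₁)⁻¹⋯o(e_k)⁻¹` of the inverses of the orientation values over
the consecutive oriented edges (darts) of a walk `p`, in order. -/
def walkProdInv {V F : Type*} [Group F] {G : SimpleGraph V} {u v : V}
    (o : V → V → F) (p : G.Walk u v) : F :=
  (p.darts.map fun d => (o d.toProd.1 d.toProd.2)⁻¹).prod

theorem walkProd_nil {V F : Type*} [Group F] {G : SimpleGraph V} {u : V} (o : V → V → F) :
    walkProd o (SimpleGraph.Walk.nil : G.Walk u u) = 1 := by
  simp [walkProd]

theorem walkProd_cons {V F : Type*} [Group F] {G : SimpleGraph V} {u v w : V}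
    (o : V → V → F) (h : G.Adj u v) (p : G.Walk v w) :
    walkProd o (SimpleGraph.Walk.cons h p) = o u v * walkProd o p := by
  simp [walkProd]

/-- In an acyclic graph, backtracking does not change the product of an antisymmetric map. -/
theorem walkProd_eq_of_isPath {V F : Type*} [Group F] {G : SimpleGraph V}
    (hG : G.IsAcyclic) (o : V → V → F) (ho : ∀ u v, G.Adj u v → o v u = (o u v)⁻¹)
    {u v : V} (p q : G.Walk u v) (hq : q.IsPath) : walkProd o p = walkProd o q := by
  classical
  induction p with
  | nil => rw [(SimpleGraph.Walk.isPath_iff_nil.mp hq).eq_nil]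
  | @cons u w v h p ih =>
    rw [walkProd_cons]
    by_cases hw : w ∈ q.support
    · have htake : q.takeUntil w hw = h.toWalk :=
        congrArg Subtype.val ((hG.subsingleton_path u w).elim
          ⟨_, hq.takeUntil hw⟩ (SimpleGraph.Path.singleton h))
      rw [ih _ (hq.dropUntil hw), ← walkProd_cons o h]
      conv_rhs => rw [← q.take_spec hw, htake]
      rfl
    · rw [ih _ (hq.cons (h := h.symm) hw), walkProd_cons, ho u w h, mul_inv_cancel_left]

/-- The twist of a walk by `o` is a walk, whose product for the inverse orientation
telescopes. -/
theorem exists_walk_walkProd_inv {V F : Type*} [Group F] [MulAction F V] {G : SimpleGraph V}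
    (hact : ∀ (g : F) (u v : V), G.Adj u v → G.Adj (g • u) (g • v)) (o : V → V → F)
    (hconj : ∀ (g : F) (u v : V), G.Adj u v → o (g • u) (g • v) = g * o u v * g⁻¹)
    (hfix : ∀ u v, G.Adj u v → o u v • v = v) {u v : V} (p : G.Walk u v) (g : F) :
    ∃ q : G.Walk (g • u) ((g * walkProd o p) • v),
      walkProd (fun a b => (o a b)⁻¹) q = g * (g * walkProd o p)⁻¹ := by
  induction p generalizing g with
  | nil =>
    rw [walkProd_nil, mul_one, mul_inv_cancel]
    exact ⟨.nil, walkProd_nil _⟩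
  | @cons u w v h p ih =>
    obtain ⟨q, hq⟩ := ih (g * o u w)
    rw [walkProd_cons, ← mul_assoc]
    have hw : (g * o u w) • w = g • w := by rw [mul_smul, hfix u w h]
    refine ⟨.cons (hw ▸ hact g u w h) q, ?_⟩
    rw [walkProd_cons, hq, hw, hconj g u w h]
    group

theorem leftInverse_of_inv_orientation {V F : Type*} [Group F] [MulAction F V]
    {G : SimpleGraph V} (hT : G.IsTree)
    (hact : ∀ (g : F) (u v : V), G.Adj u v → G.Adj (g • u) (g • v)) (o : V → V → F)
    (ho : ∀ u v, G.Adj u v → o v u = (o u v)⁻¹)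
    (hconj : ∀ (g : F) (u v : V), G.Adj u v → o (g • u) (g • v) = g * o u v * g⁻¹)
    (hfix : ∀ u v, G.Adj u v → o u v • v = v) (v₀ : V) (δ δ' : V → V)
    (hδ : ∀ (v : V) (p : G.Walk v₀ v), p.IsPath → δ v = walkProd o p • v)
    (hδ' : ∀ (v : V) (p : G.Walk v₀ v), p.IsPath →
      δ' v = walkProd (fun a b => (o a b)⁻¹) p • v) :
    Function.LeftInverse δ' δ := by
  intro v
  obtain ⟨p, hp⟩ := hT.connected.exists_isPath v₀ v
  obtain ⟨r, hr⟩ := hT.connected.exists_isPath v₀ (δ v)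
  have hδr := hδ' _ r hr
  obtain ⟨q, hq⟩ := exists_walk_walkProd_inv hact o hconj hfix p 1
  have key : ∀ (a b : V) (q : G.Walk a b) (r : G.Walk v₀ (δ v)), a = v₀ → b = δ v →
      r.IsPath → walkProd (fun a b => (o a b)⁻¹) q = walkProd (fun a b => (o a b)⁻¹) r := by
    rintro a b q r rfl rfl hr
    exact walkProd_eq_of_isPath hT.isAcyclic _ (fun u v h => by rw [ho u v h]) q r hr
  rw [hδr, ← key _ _ q r (one_smul F v₀) (by rw [one_mul, hδ v p hp]) hr, hq, hδ v p hp,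
    one_mul, one_mul, inv_smul_smul]

/-- Let `F` act on a tree `G` by graph automorphisms, with orientation `o` and
base vertex `v₀`, let `δ` be the Dehn twist map based at `v₀`, and let
`δ' v = o(e₁)⁻¹⋯o(e_k)⁻¹ • v` along the unique path from `v₀` to `v`.
Then `δ'` is a two-sided inverse of `δ`. -/
theorem dehnTwist_inverse
    {V F : Type*} [Group F] [MulAction F V]
    (G : SimpleGraph V) (hT : G.IsTree)
    (hact : ∀ (g : F) (u v : V), G.Adj u v ↔ G.Adj (g • u) (g • v))
    (o : V → V → F)
    (ho1 : ∀ u v, G.Adj u v → o v u = (o u v)⁻¹)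
    (ho2 : ∀ (g : F) (u v : V), G.Adj u v → o (g • u) (g • v) = g * o u v * g⁻¹)
    (ho3 : ∀ u v, G.Adj u v →
      (Subgroup.zpowers (o u v) : Set F) = {g : F | g • u = u ∧ g • v = v})
    (v₀ : V) (δ δ' : V → V)
    (hδ : ∀ (v : V) (p : G.Walk v₀ v), p.IsPath → δ v = walkProd o p • v)
    (hδ' : ∀ (v : V) (p : G.Walk v₀ v), p.IsPath → δ' v = walkProdInv o p • v) :
    ∀ v : V, δ (δ' v) = v ∧ δ' (δ v) = v := by
  have hfix : ∀ u v, G.Adj u v → o u v • v = v := fun u v h => by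
    have hmem : o u v ∈ (Subgroup.zpowers (o u v) : Set F) := Subgroup.mem_zpowers _
    rw [ho3 u v h] at hmem
    exact hmem.2
  have hact' := fun (g : F) (u v : V) => (hact g u v).mp
  intro v
  constructor
  · refine leftInverse_of_inv_orientation hT hact' (fun a b => (o a b)⁻¹)
      (fun u v h => by rw [ho1 u v h]) (fun g u v h => ?_) (fun u v h => ?_) v₀ δ' δ hδ' ?_ v
    · rw [ho2 g u v h]
      group
    · rw [inv_smul_eq_iff, hfix u v h]
    · simpa only [inv_inv] using hδ
  · exact leftInverse_of_inv_orientation hT hact' o ho1 ho2 hfix v₀ δ δ' hδ hδ' v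
end

section
/- (Lyndon–Schützenberger) Let F be a free group (e.g., FreeGroup α for a type α) and let x, y, z ∈ F be nontrivial elements. If x^a * y^b * z^c = 1 for some integers a, b, c ≥ 2, then x, y, and z are all powers of a single common element: there exists w ∈ F such that x, y, z all lie in the cyclic subgroup generated by w. -/
theorem Function.Periodic.exists_mem_Ico_nat {β : Type*} {f : ℕ → β} {n : ℕ}
    (hf : Function.Periodic f n) (hn : 0 < n) (p m : ℕ) : ∃ q, p ≤ q ∧ q < p + n ∧ f q = f m := by
  refine ⟨p + (m + (n - 1) * p) % n, by omega,
    by have := Nat.mod_lt (m + (n - 1) * p) hn; omega, ?_⟩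
  rw [← hf.map_mod_nat (p + _), ← hf.map_mod_nat m, Nat.add_mod_mod]
  congr 1
  have : p + (m + (n - 1) * p) = m + n * p := by
    obtain ⟨k, rfl⟩ := Nat.exists_eq_succ_of_ne_zero hn.ne'
    simp only [Nat.succ_eq_add_one, Nat.add_sub_cancel]
    ring
  rw [this, Nat.add_mul_mod_self_left]

/-- Counting edges traversed by a closed walk of period `N`, whose positions carry heights of period
`n`, through those edges one of whose ends is at maximal height. -/
theorem ncard_range_add_le_ncard_range {V E L : Type*} [LinearOrder L] {v : ℕ → V} {ε : ℕ → E}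
    {η : ℕ → L} {n C : ℕ} (hn : 0 < n) (hC : 0 < C) (hv : Function.Periodic v (C * n))
    (hε : Function.Periodic ε (C * n)) (hη : Function.Periodic η n)
    (hsep : ∀ i j, v i = v j → η i = η j → i ≡ j [MOD C * n])
    (hedge : ∀ i j, ε i = ε j →
      (v i = v j ∧ v (i + 1) = v (j + 1) ∧ (η i < η j ↔ η (i + 1) < η (j + 1)) ∧
        (η j < η i ↔ η (j + 1) < η (i + 1))) ∨
      (v i = v (j + 1) ∧ v (i + 1) = v j ∧ (η i < η (j + 1) ↔ η (i + 1) < η j) ∧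
        (η (j + 1) < η i ↔ η j < η (i + 1)) ∧ ¬ i ≡ j + 1 [MOD C * n]))
    (hmult : ∀ j, ∃ i, ¬ i ≡ j [MOD C * n] ∧ v i = v j) :
    (Set.range v).ncard + C ≤ (Set.range ε).ncard := by
  classical
  set N := C * n with hN
  have hNpos : 0 < N := Nat.mul_pos hC hn
  have hηN : Function.Periodic η N := hη.nat_mul C
  let top : ℕ → Prop := fun j ↦ ∀ i, v i = v j → η i ≤ η j
  have htop_congr : ∀ i j, v i = v j → η i = η j → (top i ↔ top j) := by
    intro i j h1 h2
    simp only [top, h1, h2]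
  have htop_mod : ∀ j, top (j % N) ↔ top j := fun j ↦
    htop_congr _ _ (hv.map_mod_nat j) (hηN.map_mod_nat j)
  have htop_mod_succ : ∀ j, top (j % N + 1) ↔ top (j + 1) := fun j ↦ by
    rw [← htop_mod (j % N + 1), ← htop_mod (j + 1), Nat.mod_add_mod]
  let T := (Finset.range N).filter top
  let X := (Finset.range N).filter fun j ↦ ¬ top j ∧ top (j + 1)
  have hnottop : ∀ i j, v i = v j → η i < η j → ¬ top i := fun i j h1 h2 h3 ↦
    (h3 j h1.symm).not_gt h2
  have hlt : ∀ i j, top i → v j = v i → ¬ i ≡ j [MOD N] → η j < η i := fun i j hi hij hne ↦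
    lt_of_le_of_ne (hi j hij) fun h ↦ hne (hsep i j hij.symm h.symm)
  have hinj : Set.InjOn ε ↑(T ∪ X) := by
    intro i hi j hj hij
    simp only [T, X, Finset.coe_union, Finset.coe_filter, Finset.mem_range, Set.mem_union,
      Set.mem_ofPred_eq] at hi hj
    have hiN : i < N := by tauto
    have hjN : j < N := by tauto
    have hi' : top i ∨ top (i + 1) := by tauto
    have hj' : top j ∨ top (j + 1) := by tauto
    by_contra hne
    have hmod : ¬ i ≡ j [MOD N] := fun h ↦ hne (h.eq_of_lt_of_lt hiN hjN)
    have hmod' : ¬ i + 1 ≡ j + 1 [MOD N] := fun h ↦ hmod (Nat.ModEq.add_right_cancel' 1 h)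
    rcases hedge i j hij with ⟨h1, h2, -, h4⟩ | ⟨h1, h2, h3, h4, h5⟩
    · have : η j < η i := by
        rcases hi' with hi' | hi'
        · exact hlt i j hi' h1.symm hmod
        · exact h4.mpr (hlt (i + 1) (j + 1) hi' h2.symm hmod')
      rcases hj' with hj' | hj'
      · exact hnottop j i h1.symm this hj'
      · exact hnottop (j + 1) (i + 1) h2.symm (h4.mp this) hj'
    · have : η (j + 1) < η i := by
        rcases hi' with hi' | hi'
        · exact hlt i (j + 1) hi' h1.symm h5
        · refine h4.mpr (lt_of_le_of_ne (hi' j h2.symm) fun h ↦ h5 (hsep i (j + 1) h1 ?_))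
          rw [h] at h3 h4
          exact le_antisymm (not_lt.mp fun h ↦ (lt_irrefl _ (h4.mp h)))
            (not_lt.mp fun h ↦ (lt_irrefl _ (h3.mp h)))
      rcases hj' with hj' | hj'
      · exact hnottop j (i + 1) h2.symm (h4.mp this) hj'
      · exact hnottop (j + 1) i h1.symm this hj'
  have hεfin : (Set.range ε).Finite := by
    refine ((Finset.range N).finite_toSet.image ε).subset ?_
    rintro _ ⟨j, rfl⟩
    exact ⟨j % N, by simpa using Nat.mod_lt j hNpos, hε.map_mod_nat j⟩
  have hSle : (T ∪ X).card ≤ (Set.range ε).ncard := by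
    rw [← Set.ncard_coe_finset, ← hinj.ncard_image]
    exact Set.ncard_le_ncard (Set.image_subset_range _ _) hεfin
  have hdisj : Disjoint T X := by
    refine Finset.disjoint_left.mpr fun j hj hj' ↦ ?_
    simp only [T, X, Finset.mem_filter] at hj hj'
    exact hj'.2.1 hj.2
  rw [Finset.card_union_of_disjoint hdisj] at hSle
  have hT : (Set.range v).ncard ≤ T.card := by
    have hsub : Set.range v ⊆ v '' T := by
      rintro _ ⟨j, rfl⟩
      obtain ⟨i, hi, hmax⟩ := ((Finset.range N).filter fun i ↦ v i = v j).exists_max_image η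
        ⟨j % N, by simpa using ⟨Nat.mod_lt j hNpos, hv.map_mod_nat j⟩⟩
      simp only [Finset.mem_filter, Finset.mem_range] at hi hmax
      refine ⟨i, ?_, hi.2⟩
      simp only [T, Finset.coe_filter, Finset.mem_range, Set.mem_ofPred_eq]
      refine ⟨hi.1, fun k hk ↦ ?_⟩
      rw [← hηN.map_mod_nat k]
      exact hmax _ ⟨Nat.mod_lt k hNpos, by rw [hv.map_mod_nat, hk, hi.2]⟩
    calc _ ≤ (v '' T).ncard := Set.ncard_le_ncard hsub (T.finite_toSet.image v)
      _ ≤ (T : Set ℕ).ncard := Set.ncard_image_le T.finite_toSet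
      _ = T.card := Set.ncard_coe_finset T
  have hX : C ≤ X.card := by
    obtain ⟨p, -, hp⟩ := (Finset.range n).exists_min_image η ⟨0, by simpa⟩
    obtain ⟨m, -, hm⟩ := (Finset.range n).exists_max_image η ⟨0, by simpa⟩
    have hp' : ∀ i, η p ≤ η i := fun i ↦ by
      rw [← hη.map_mod_nat i]; exact hp _ (by simpa using Nat.mod_lt i hn)
    have hm' : ∀ i, η i ≤ η m := fun i ↦ by
      rw [← hη.map_mod_nat i]; exact hm _ (by simpa using Nat.mod_lt i hn)
    have hcross : ∀ k : ℕ, ∃ j, p + k * n ≤ j ∧ j < p + k * n + n ∧ ¬ top j ∧ top (j + 1) := by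
      intro k
      have hηk : η (p + k * n) = η p := hη.nat_mul k p
      have hbot : ¬ top (p + k * n) := by
        obtain ⟨i, hi, hvi⟩ := hmult (p + k * n)
        refine hnottop _ i hvi.symm (lt_of_le_of_ne ?_ fun h ↦ hi (hsep _ _ hvi h.symm))
        rw [hηk]
        exact hp' i
      obtain ⟨q, hq1, hq2, hq⟩ := hη.exists_mem_Ico_nat hn (p + k * n) m
      have htopq : top q := fun i _ ↦ hq ▸ hm' i
      by_contra! hcon
      have : ∀ d, p + k * n + d ≤ q → ¬ top (p + k * n + d) := by
        intro d
        induction d with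
        | zero => exact fun _ ↦ hbot
        | succ d ih => exact fun hd ↦ hcon (p + k * n + d) (by omega) (by omega) (ih (by omega))
      refine this (q - (p + k * n)) (by omega) ?_
      rwa [Nat.add_sub_cancel' hq1]
    choose c hc1 hc2 hc3 hc4 using hcross
    rw [← Finset.card_range C]
    refine Finset.card_le_card_of_injOn (fun k ↦ c k % N) (fun k _ ↦ ?_) ?_
    · simp only [X, Finset.coe_filter, Finset.mem_range, Set.mem_ofPred_eq]
      exact ⟨Nat.mod_lt _ hNpos, (htop_mod _).not.mpr (hc3 k), (htop_mod_succ _).mpr (hc4 k)⟩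
    · have hlt : ∀ k k', k < k' → k' < C → ¬ c k ≡ c k' [MOD N] := by
        intro k k' hkk hkC h
        have h1 := hc1 k
        have h2 := hc2 k
        have h3 := hc1 k'
        have h4 := hc2 k'
        have h5 : (k + 1) * n ≤ k' * n := Nat.mul_le_mul_right n hkk
        have h6 : (k' + 1) * n ≤ N := Nat.mul_le_mul_right n hkC
        rw [add_mul, one_mul] at h5 h6
        have h7 := (Nat.modEq_iff_dvd' (by omega)).mp h
        have := Nat.eq_zero_of_dvd_of_lt h7 (by omega)
        omega
      intro k hk k' hk' h
      simp only [Finset.coe_range, Set.mem_Iio] at hk hk'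
      rcases lt_trichotomy k k' with hlt' | rfl | hlt'
      · exact (hlt k k' hlt' hk' h).elim
      · rfl
      · exact (hlt k' k hlt' hk h.symm).elim
  omega

namespace FreeGroup

theorem isCyclic_of_subsingleton_generators (G : Type*) [Group G] [IsFreeGroup G]
    [Subsingleton (IsFreeGroup.Generators G)] : IsCyclic G := by
  have : IsCyclic (FreeGroup (IsFreeGroup.Generators G)) := by
    rcases isEmpty_or_nonempty (IsFreeGroup.Generators G) with h | ⟨⟨i⟩⟩
    · infer_instance
    · have : Unique (IsFreeGroup.Generators G) := uniqueOfSubsingleton i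
      infer_instance
  exact isCyclic_of_surjective (IsFreeGroup.mulEquiv G) (IsFreeGroup.mulEquiv G).surjective

theorem not_commute_of_of {ι : Type*} {i j : ι} (hij : i ≠ j) :
    ¬ Commute (FreeGroup.of i) (FreeGroup.of j) := by
  classical
  intro h
  have h' := congrArg toWord h.eq
  simp [of, reduce.cons, hij, toWord_mk] at h'

theorem isCyclic_of_commute (G : Type*) [Group G] [IsFreeGroup G]
    (h : ∀ u v : G, Commute u v) : IsCyclic G := by
  have : Subsingleton (IsFreeGroup.Generators G) := by
    refine ⟨fun i j ↦ by_contra fun hij ↦ not_commute_of_of hij ?_⟩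
    have := (h (IsFreeGroup.mulEquiv G (of i)) (IsFreeGroup.mulEquiv G (of j))).map
      (IsFreeGroup.mulEquiv G).symm.toMonoidHom
    simpa using this
  exact isCyclic_of_subsingleton_generators G

/-- Homomorphisms from a free group of rank two to a finite group may be prescribed on any
generating pair. -/
theorem exists_hom_of_closure_pair {G : Type*} [Group G] [IsFreeGroup G] {x y : G}
    (hxy : ¬ Commute x y) (hgen : Subgroup.closure {x, y} = ⊤)
    {Q : Type*} [Group Q] [Finite Q] (g h : Q) : ∃ f : G →* Q, f x = g ∧ f y = h := by
  classical
  have hinj : Function.Injective fun f : G →* Q ↦ (f x, f y) := by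
    intro f₁ f₂ hf
    refine MonoidHom.eq_of_eqOn_dense hgen ?_
    rintro _ (rfl | rfl)
    · exact congrArg Prod.fst hf
    · exact congrArg Prod.snd hf
  obtain ⟨i, j, hij⟩ : ∃ i j : IsFreeGroup.Generators G, i ≠ j := by
    by_contra! hsub
    have : Subsingleton (IsFreeGroup.Generators G) := ⟨hsub⟩
    have := isCyclic_of_subsingleton_generators G
    exact hxy (IsCyclic.commGroup (α := G) |>.mul_comm x y)
  have hemb : Function.Injective fun q : Q × Q ↦
      IsFreeGroup.lift (G := G) (Function.update (fun _ ↦ q.2) i q.1) := by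
    intro q r hqr
    have := IsFreeGroup.lift.injective hqr
    refine Prod.ext ?_ ?_
    · simpa using congrFun this i
    · simpa [Function.update_of_ne hij.symm] using congrFun this j
  obtain ⟨q, hq⟩ := Finite.surjective_of_injective (hinj.comp hemb) (g, h)
  exact ⟨_, congrArg Prod.fst hq, congrArg Prod.snd hq⟩

theorem exists_prime_unit_orderOf {N : ℕ} (hN : N ≠ 0) :
    ∃ p : ℕ, p.Prime ∧ ∃ γ : (ZMod p)ˣ, orderOf γ = N := by
  obtain ⟨p, hp, -, hmod⟩ := Nat.exists_prime_gt_modEq_one 0 hN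
  have : Fact p.Prime := ⟨hp⟩
  obtain ⟨γ, hγ⟩ := IsCyclic.exists_ofOrder_eq_natCard (α := (ZMod p)ˣ)
  rw [Nat.card_eq_fintype_card, ZMod.card_units] at hγ
  obtain ⟨m, hm⟩ := (Nat.modEq_iff_dvd' hp.one_le).mp hmod.symm
  have hpos : 0 < p - 1 := Nat.sub_pos_of_lt hp.one_lt
  refine ⟨p, hp, γ ^ m, ?_⟩
  rw [hm] at hpos
  have hm0 : m ≠ 0 := by rintro rfl; simp at hpos
  rw [orderOf_pow_of_dvd hm0 (by rw [hγ, hm]; exact dvd_mul_left _ _), hγ, hm,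
    Nat.mul_div_cancel _ (Nat.pos_of_ne_zero hm0)]

/-- Along a homomorphism to affine permutations, the slope of a word in `x` and `y` is determined
by its exponent sums. -/
theorem exists_slope_exponents {G : Type*} [Group G] {x y q : G}
    (hq : q ∈ Subgroup.closure {x, y}) :
    ∃ i j : ℤ, ∀ (p : ℕ) (f : G →* Equiv.Perm (ZMod p)) (α β : (ZMod p)ˣ),
      (∀ s t, f x s - f x t = α * (s - t)) → (∀ s t, f y s - f y t = β * (s - t)) →
      ∀ s t, f q s - f q t = ↑(α ^ i * β ^ j) * (s - t) := by
  induction hq using Subgroup.closure_induction with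
  | mem u hu =>
    rcases hu with rfl | rfl
    · exact ⟨1, 0, fun p f α β hx _ ↦ by simpa using hx⟩
    · exact ⟨0, 1, fun p f α β _ hy ↦ by simpa using hy⟩
  | one => exact ⟨0, 0, fun p f α β _ _ ↦ by simp⟩
  | mul u v _ _ hu hv =>
    obtain ⟨i, j, hu⟩ := hu
    obtain ⟨i', j', hv⟩ := hv
    refine ⟨i + i', j + j', fun p f α β hx hy s t ↦ ?_⟩
    rw [_root_.map_mul, Equiv.Perm.mul_apply, Equiv.Perm.mul_apply, hu p f α β hx hy,
      hv p f α β hx hy, zpow_add, zpow_add, ← mul_assoc, ← Units.val_mul]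
    congr 2
    exact mul_mul_mul_comm _ _ _ _
  | inv u _ hu =>
    obtain ⟨i, j, hu⟩ := hu
    refine ⟨-i, -j, fun p f α β hx hy s t ↦ ?_⟩
    have h := hu p f α β hx hy ((f u)⁻¹ s) ((f u)⁻¹ t)
    simp only [← Equiv.Perm.mul_apply, mul_inv_cancel, Equiv.Perm.one_apply] at h
    rw [h, _root_.map_inv, ← mul_assoc, ← Units.val_mul]
    simp [mul_mul_mul_comm]

/-- In a free group of rank two, `x ^ a * y ^ b` is not a proper power, for a generating pair
`x, y`. -/
theorem not_isPow_pow_mul_pow {G : Type*} [Group G] [IsFreeGroup G] {x y q : G}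
    (hxy : ¬ Commute x y) (hgen : Subgroup.closure {x, y} = ⊤) {a b k : ℕ}
    (ha : 1 ≤ a) (hb : 1 ≤ b) (hk : 2 ≤ k) : q ^ k ≠ x ^ a * y ^ b := by
  intro h
  obtain ⟨i, j, hij⟩ := exists_slope_exponents (x := x) (y := y) (q := q) (by simp [hgen])
  have haff : ∀ (p : ℕ) (α β : (ZMod p)ˣ), p.Prime → ∃ f : G →* Equiv.Perm (ZMod p),
      (∀ t, f x t = α * t) ∧ ∀ t, f y t = β * (t - 1) + 1 := by
    intro p α β hp
    have : NeZero p := ⟨hp.ne_zero⟩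
    obtain ⟨f, hfx, hfy⟩ := exists_hom_of_closure_pair hxy hgen α.mulLeft
      ((Equiv.subRight 1).trans (β.mulLeft.trans (Equiv.addRight 1)))
    exact ⟨f, fun t ↦ by simp [hfx], fun t ↦ by simp [hfy]⟩
  have hpowx : ∀ (p : ℕ) (f : G →* Equiv.Perm (ZMod p)) (u : G) (δ : (ZMod p)ˣ) (c : ZMod p),
      (∀ t, f u t = δ * (t - c) + c) → ∀ (m : ℕ) t, f (u ^ m) t = ↑(δ ^ m) * (t - c) + c := by
    intro p f u δ c hu m
    induction m with
    | zero => simp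
    | succ m ih =>
      intro t
      rw [pow_succ', _root_.map_mul, Equiv.Perm.mul_apply, ih, hu, pow_succ']
      push_cast
      ring
  have hrel : ∀ (p : ℕ) (α β : (ZMod p)ˣ), p.Prime →
      (α ^ i * β ^ j) ^ k = α ^ a * β ^ b := by
    intro p α β hp
    obtain ⟨f, hfx, hfy⟩ := haff p α β hp
    have hq := hij p f α β (fun s t ↦ by rw [hfx, hfx]; ring) fun s t ↦ by rw [hfy, hfy]; ring
    have hqk : ∀ (m : ℕ) s t, f (q ^ m) s - f (q ^ m) t = ↑((α ^ i * β ^ j) ^ m) * (s - t) := by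
      intro m
      induction m with
      | zero => simp
      | succ m ih =>
        intro s t
        rw [pow_succ', _root_.map_mul, Equiv.Perm.mul_apply, Equiv.Perm.mul_apply, hq, ih,
          pow_succ', ← mul_assoc, ← Units.val_mul]
    have h1 := hqk k 1 0
    rw [h, _root_.map_mul, Equiv.Perm.mul_apply, Equiv.Perm.mul_apply, hpowx p f y β 1 hfy,
      hpowx p f y β 1 hfy, hpowx p f x α 0 (by simpa using hfx),
      hpowx p f x α 0 (by simpa using hfx)] at h1
    apply Units.ext
    push_cast at h1 ⊢
    linear_combination -h1
  have hexp : ∀ c d : ℤ, (∀ (p : ℕ) (γ : (ZMod p)ˣ), p.Prime → γ ^ c = γ ^ d) → c = d := by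
    intro c d hcd
    obtain ⟨p, hp, γ, hγ⟩ := exists_prime_unit_orderOf (N := (c - d).natAbs + 1) (by omega)
    have h1 : γ ^ (c - d) = 1 := by rw [zpow_sub, hcd p γ hp, mul_inv_cancel]
    rw [← orderOf_dvd_iff_zpow_eq_one, hγ] at h1
    have := Int.eq_zero_of_abs_lt_dvd h1 (by push_cast; exact lt_add_one _)
    omega
  have hia : i * k = a := hexp _ _ fun p γ hp ↦ by
    have := hrel p γ 1 hp
    rw [zpow_mul]
    simpa using this
  have hjb : j * k = b := hexp _ _ fun p γ hp ↦ by
    have := hrel p 1 γ hp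
    rw [zpow_mul]
    simpa using this
  have hi : 0 < i := by by_contra!; nlinarith
  have hj : 0 < j := by by_contra!; nlinarith
  lift i to ℕ using hi.le
  lift j to ℕ using hj.le
  norm_cast at hia hjb hi hj
  obtain ⟨p, hp, γ, hγ⟩ := exists_prime_unit_orderOf (N := j * (i + 1) * k) (by positivity)
  obtain ⟨f, hfx, hfy⟩ := haff p (γ ^ j) γ hp
  have hη : (γ ^ j) ^ (i : ℤ) * γ ^ (j : ℤ) = γ ^ (j * (i + 1)) := by
    rw [zpow_natCast, zpow_natCast, ← pow_mul, ← pow_add, mul_add, mul_one]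
  have hq := hij p f (γ ^ j) γ (fun s t ↦ by rw [hfx, hfx]; ring)
    fun s t ↦ by rw [hfy, hfy]; ring
  rw [hη] at hq
  have hη1 : γ ^ (j * (i + 1)) ≠ 1 := by
    rw [Ne, ← orderOf_dvd_iff_pow_eq_one, hγ]
    exact Nat.not_dvd_of_pos_of_lt (by positivity) (by nlinarith [Nat.mul_pos hj (Nat.succ_pos i)])
  have hηk : (γ ^ (j * (i + 1))) ^ k = 1 := by
    rw [← pow_mul, ← orderOf_dvd_iff_pow_eq_one, hγ]
  have : Fact p.Prime := ⟨hp⟩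
  have hne : (1 : ZMod p) - (γ ^ (j * (i + 1)) : (ZMod p)ˣ) ≠ 0 := by
    rw [sub_ne_zero]
    exact fun h ↦ hη1 (Units.ext h.symm)
  have hfq : ∀ t, f q t = ↑(γ ^ (j * (i + 1))) *
      (t - f q 0 / (1 - (γ ^ (j * (i + 1)) : (ZMod p)ˣ))) +
      f q 0 / (1 - (γ ^ (j * (i + 1)) : (ZMod p)ˣ)) := by
    intro t
    have := hq t 0
    field_simp
    linear_combination (1 - ((γ ^ (j * (i + 1)) : (ZMod p)ˣ) : ZMod p)) * this
  have hone := hpowx p f q _ _ hfq k 1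
  rw [hηk, h, _root_.map_mul, Equiv.Perm.mul_apply, hpowx p f y γ 1 hfy,
    hpowx p f x (γ ^ j) 0 (by simpa using hfx)] at hone
  have hx1 : (γ ^ j) ^ a = 1 := Units.ext (by simpa using hone)
  rw [← pow_mul, ← orderOf_dvd_iff_pow_eq_one, hγ, ← hia, ← mul_assoc,
    Nat.mul_dvd_mul_iff_right (by omega), Nat.mul_dvd_mul_iff_left hj] at hx1
  exact Nat.not_dvd_of_pos_of_lt hi (Nat.lt_succ_self i) hx1

section Magnus

variable {α : Type*}

open Classical in
/-- Prepend the letter `e` to each basis word not starting with `e`, and kill the others. -/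
noncomputable def prepend (e : α) : Module.End ℤ (List α →₀ ℤ) :=
  Finsupp.linearCombination ℤ fun w ↦ if w.head? = some e then 0 else Finsupp.single (e :: w) 1

theorem prepend_single (e : α) (w : List α) [Decidable (w.head? = some e)] :
    prepend e (Finsupp.single w 1) =
      if w.head? = some e then 0 else Finsupp.single (e :: w) 1 := by
  simp only [prepend, Finsupp.linearCombination_single, one_smul]
  congr

theorem prepend_mul_self (e : α) : prepend e * prepend e = 0 := by
  classical
  ext w : 2
  by_cases h : w.head? = some e <;> simp [Module.End.mul_apply, prepend_single, h]

theorem prepend_apply_cons (e : α) (f : List α →₀ ℤ) {t : List α} (ht : t.head? ≠ some e) :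
    prepend e f (e :: t) = f t := by
  classical
  induction f using Finsupp.induction_linear with
  | zero => simp
  | add f g hf hg => simp [hf, hg]
  | single w c =>
    rw [← mul_one c, ← smul_eq_mul, ← Finsupp.smul_single, map_smul, prepend_single]
    by_cases h : w.head? = some e
    · have : w ≠ t := by rintro rfl; exact ht h
      simp [h, this]
    · simp [h, Finsupp.single_apply]

theorem prepend_apply_eq_zero (e : α) (f : List α →₀ ℤ) {w : List α}
    (hw : ∀ t, t.head? ≠ some e → w ≠ e :: t) : prepend e f w = 0 := by
  classical
  induction f using Finsupp.induction_linear with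
  | zero => simp
  | add f g hf hg => simp [hf, hg]
  | single u c =>
    rw [← mul_one c, ← smul_eq_mul, ← Finsupp.smul_single, map_smul, prepend_single]
    by_cases h : u.head? = some e
    · simp [h]
    · simp [h, (hw u h).symm]

/-- The Magnus representation, in which each generator acts as a unipotent operator. -/
noncomputable def magnus : FreeGroup α →* (Module.End ℤ (List α →₀ ℤ))ˣ :=
  FreeGroup.lift fun e ↦
    { val := 1 + prepend e
      inv := 1 - prepend e
      val_inv := by rw [mul_sub, add_mul, add_mul, prepend_mul_self]; simp
      inv_val := by rw [sub_mul, mul_add, mul_add, prepend_mul_self]; simp }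

theorem magnus_mk_cons (e : α) (ε : Bool) (L : List (α × Bool)) (v : List α →₀ ℤ)
    (w : List α) :
    (magnus (mk ((e, ε) :: L))).val v w = (magnus (mk L)).val v w +
      (if ε then 1 else -1) * prepend e ((magnus (mk L)).val v) w := by
  have : (mk ((e, ε) :: L) : FreeGroup α) = mk [(e, ε)] * mk L := by rw [mul_mk]; rfl
  rw [this, _root_.map_mul, Units.val_mul, Module.End.mul_apply]
  cases ε <;> simp [magnus, sub_eq_add_neg]

theorem exists_magnus_mk_coeff {e : α} {ε : Bool} {L : List (α × Bool)}
    (hL : IsReduced ((e, ε) :: L)) :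
    ∃ (t : List α) (k : ℕ), t.head? ≠ some e ∧
      (magnus (mk ((e, ε) :: L))).val (Finsupp.single [] 1) t ≠ 0 ∧
      (magnus (mk ((e, ε) :: L))).val (Finsupp.single [] 1) (e :: t) =
        (if ε then 1 else -1) * (k + 1) *
          (magnus (mk ((e, ε) :: L))).val (Finsupp.single [] 1) t ∧
      ∀ w, (magnus (mk ((e, ε) :: L))).val (Finsupp.single [] 1) w ≠ 0 →
        List.Sublist w (e :: t) := by
  induction L generalizing e ε with
  | nil =>
    refine ⟨[], 0, by simp, ?_, ?_, ?_⟩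
    · simp [magnus_mk_cons, ← one_eq_mk, prepend_apply_eq_zero]
    · have := prepend_apply_cons e (Finsupp.single [] 1) (t := []) (by simp)
      simp [magnus_mk_cons, ← one_eq_mk, this, prepend_apply_eq_zero]
    · intro w hw
      rw [magnus_mk_cons] at hw
      by_contra hcon
      refine hw ?_
      have h1 : w ≠ [] := by rintro rfl; simp at hcon
      have h2 : w ≠ [e] := by rintro rfl; simp at hcon
      classical
      simp [← one_eq_mk, prepend_single, h1.symm, h2.symm]
  | cons b L ih =>
    obtain ⟨e', ε'⟩ := b
    have hred := isReduced_cons_cons.mp hL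
    obtain ⟨t, k, ht, hft, hk, hsub⟩ := ih hred.2
    set f := (magnus (mk ((e', ε') :: L))).val (Finsupp.single [] 1) with hf
    have hval : ∀ w, (magnus (mk ((e, ε) :: (e', ε') :: L))).val (Finsupp.single [] 1) w =
        f w + (if ε then 1 else -1) * prepend e f w := by
      intro w
      rw [magnus_mk_cons]
    simp only [hval]
    by_cases he : e = e'
    · obtain rfl := he
      obtain rfl : ε = ε' := hred.1 rfl
      have h0 : prepend e f t = 0 := prepend_apply_eq_zero _ _ (by rintro s - rfl; simp at ht)
      refine ⟨t, k + 1, ht, by rw [h0]; simpa using hft, ?_, fun w hw ↦ ?_⟩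
      · rw [prepend_apply_cons e f ht, hk, h0]
        push_cast
        ring
      · by_cases hfw : f w = 0
        · have hp : prepend e f w ≠ 0 := by rintro h; simp [hfw, h] at hw
          obtain ⟨s, hs, rfl⟩ : ∃ s, s.head? ≠ some e ∧ w = e :: s := by
            by_contra! hcon
            exact hp (prepend_apply_eq_zero _ _ hcon)
          rw [prepend_apply_cons e f hs] at hp
          refine List.Sublist.cons_cons _ ?_
          rcases hsub s hp with _ | h | h
          · assumption
          · simp at hs
        · exact hsub w hfw
    · have h0 : prepend e f (e' :: t) = 0 := prepend_apply_eq_zero _ _ (by grind)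
      have hne : f (e' :: t) ≠ 0 := by
        rw [hk]
        refine mul_ne_zero (mul_ne_zero (by split_ifs <;> simp) (by positivity)) hft
      have hlong : f (e :: e' :: t) = 0 := by
        by_contra hcon
        have := (hsub _ hcon).length_le
        simp at this
      refine ⟨e' :: t, 0, by simpa using Ne.symm he, by rw [h0]; simpa using hne, ?_,
        fun w hw ↦ ?_⟩
      · rw [prepend_apply_cons e f (by simpa using Ne.symm he), hlong, h0]
        simp
      · by_cases hfw : f w = 0
        · have hp : prepend e f w ≠ 0 := by rintro h; simp [hfw, h] at hw
          obtain ⟨s, hs, rfl⟩ : ∃ s, s.head? ≠ some e ∧ w = e :: s := by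
            by_contra! hcon
            exact hp (prepend_apply_eq_zero _ _ hcon)
          rw [prepend_apply_cons e f hs] at hp
          exact (hsub s hp).cons_cons _
        · exact (hsub w hfw).cons _

theorem magnus_injective : Function.Injective (magnus (α := α)) := by
  classical
  rw [injective_iff_map_eq_one]
  intro g hg
  by_contra hne
  have hmk : mk g.toWord = g := mk_toWord
  have hred : IsReduced g.toWord := isReduced_toWord
  rcases hw : g.toWord with _ | ⟨⟨e, ε⟩, L⟩
  · exact hne (toWord_eq_nil_iff.mp hw)
  · rw [hw] at hmk hred
    obtain ⟨t, k, ht, hft, hk, -⟩ := exists_magnus_mk_coeff hred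
    rw [hmk, hg] at hft hk
    have h1 : (Finsupp.single ([] : List α) (1 : ℤ)) (e :: t) = 0 := by simp
    rw [Units.val_one, Module.End.one_apply] at hft hk
    rw [h1] at hk
    refine mul_ne_zero (mul_ne_zero ?_ ?_) hft hk.symm
    · split_ifs <;> simp
    · positivity

/-- Operators raising the length of words by at least `d`. -/
def lengthFiltration (α : Type*) (d : ℕ) : AddSubgroup (Module.End ℤ (List α →₀ ℤ)) where
  carrier := {T | ∀ w w' : List α, w'.length < w.length + d → T (Finsupp.single w 1) w' = 0}
  zero_mem' := by simp
  add_mem' {S T} hS hT w w' h := by simp [hS w w' h, hT w w' h]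
  neg_mem' {T} hT w w' h := by simp [hT w w' h]

theorem mul_mem_lengthFiltration {i j : ℕ} {S T : Module.End ℤ (List α →₀ ℤ)}
    (hS : S ∈ lengthFiltration α i) (hT : T ∈ lengthFiltration α j) :
    S * T ∈ lengthFiltration α (i + j) := by
  intro w w' h
  rw [Module.End.mul_apply, ← Finsupp.sum_single (T (Finsupp.single w 1)), Finsupp.sum, map_sum,
    Finsupp.finsetSum_apply]
  refine Finset.sum_eq_zero fun u hu ↦ ?_
  rw [← mul_one ((T (Finsupp.single w 1)) u), ← smul_eq_mul, ← Finsupp.smul_single, map_smul,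
    Finsupp.smul_apply]
  by_cases hlen : u.length < w.length + j
  · rw [hT w u hlen, zero_smul]
  · rw [hS u w' (by omega), smul_zero]

theorem lengthFiltration_succ_le (d : ℕ) : lengthFiltration α (d + 1) ≤ lengthFiltration α d :=
  fun _ hT w w' h ↦ hT w w' (by omega)

theorem prepend_mem_lengthFiltration (e : α) : prepend e ∈ lengthFiltration α 1 := by
  classical
  intro w w' h
  rw [prepend_single]
  have : e :: w ≠ w' := by rintro rfl; simp at h
  split_ifs <;> simp [this]

theorem magnus_sub_one_mem (g : FreeGroup α) :
    (magnus g).val - 1 ∈ lengthFiltration α 1 := by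
  have hmul : ∀ S T : Module.End ℤ (List α →₀ ℤ), S - 1 ∈ lengthFiltration α 1 →
      T - 1 ∈ lengthFiltration α 1 → S * T - 1 ∈ lengthFiltration α 1 := by
    intro S T hS hT
    have : S * T - 1 = (S - 1) * (T - 1) + (S - 1) + (T - 1) := by noncomm_ring
    rw [this]
    exact add_mem (add_mem (lengthFiltration_succ_le 1 (mul_mem_lengthFiltration hS hT)) hS) hT
  induction g using FreeGroup.induction_on with
  | C1 => simp
  | of e => simpa [magnus] using prepend_mem_lengthFiltration e
  | inv_of e _ => simpa [magnus] using neg_mem (prepend_mem_lengthFiltration e)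
  | mul u v hu hv =>
    rw [_root_.map_mul, Units.val_mul]
    exact hmul _ _ hu hv

theorem magnus_conj_sub_mem {d : ℕ} {T : Module.End ℤ (List α →₀ ℤ)}
    (hT : T ∈ lengthFiltration α d) (g : FreeGroup α) :
    (magnus g).val * T * (magnus g⁻¹).val - T ∈ lengthFiltration α (d + 1) := by
  have h1 := magnus_sub_one_mem g
  have h2 := magnus_sub_one_mem g⁻¹
  have : (magnus g).val * T * (magnus g⁻¹).val - T =
      ((magnus g).val - 1) * T * ((magnus g⁻¹).val - 1) + ((magnus g).val - 1) * T +
        T * ((magnus g⁻¹).val - 1) := by noncomm_ring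
  rw [this]
  have h3 := mul_mem_lengthFiltration h1 hT
  rw [add_comm 1 d] at h3
  exact add_mem (add_mem (lengthFiltration_succ_le _ (mul_mem_lengthFiltration h3 h2)) h3)
    (mul_mem_lengthFiltration hT h2)

/-- A free group carries a linear order invariant under conjugation. -/
theorem exists_linearOrder_conj_lt (α : Type*) :
    ∃ _ : LinearOrder (FreeGroup α), ∀ g u v : FreeGroup α,
      u < v → g * u * g⁻¹ < g * v * g⁻¹ := by
  classical
  let P := List α × List α
  let : LinearOrder P := linearOrderOfSTO (WellOrderingRel : P → P → Prop)
  have : WellFoundedLT P := ⟨WellOrderingRel.isWellOrder.wf⟩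
  let entry : Module.End ℤ (List α →₀ ℤ) → (ℕ ×ₗ P) → ℤ := fun T i ↦
    if (ofLex i).2.2.length = (ofLex i).2.1.length + (ofLex i).1
    then T (Finsupp.single (ofLex i).2.1 1) (ofLex i).2.2 else 0
  have hentry_sub : ∀ S T i, entry (S - T) i = entry S i - entry T i := by
    intro S T i
    simp only [entry]
    split_ifs <;> simp
  have hentry_zero : ∀ d T, T ∈ lengthFiltration α (d + 1) → ∀ i, (ofLex i).1 ≤ d →
      entry T i = 0 := by
    intro d T hT i hi
    simp only [entry]
    split_ifs with h
    · exact hT _ _ (by omega)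
    · rfl
  have hdiff : ∀ u v : FreeGroup α, (magnus u).val - (magnus v).val ∈ lengthFiltration α 1 := by
    intro u v
    have := sub_mem (magnus_sub_one_mem u) (magnus_sub_one_mem v)
    simpa using this
  have hmem : ∀ d T, T ∈ lengthFiltration α 0 → (∀ i, (ofLex i).1 < d → entry T i = 0) →
      T ∈ lengthFiltration α d := by
    intro d T hT hi w w' hlen
    by_cases h0 : w'.length < w.length
    · exact hT w w' (by omega)
    · have h1 := hi (toLex (w'.length - w.length, (w, w')))
        (by change w'.length - w.length < d; omega)
      have h2 : w'.length = w.length + (w'.length - w.length) := by omega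
      exact (if_pos h2).symm.trans h1
  let key : FreeGroup α → Lex ((ℕ ×ₗ P) → ℤ) := fun u ↦ toLex (entry (magnus u).val)
  have hkey : Function.Injective key := by
    intro u v huv
    apply magnus_injective
    apply Units.ext
    have h0 : ∀ i, entry ((magnus u).val - (magnus v).val) i = 0 := by
      intro i
      rw [hentry_sub, sub_eq_zero]
      exact congrFun (toLex.injective huv) i
    rw [← sub_eq_zero]
    ext w w'
    exact hmem (w'.length + 1) _ (lengthFiltration_succ_le 0 (hdiff u v)) (fun i _ ↦ h0 i) w w'
      (by omega)
  let ord : LinearOrder (FreeGroup α) := LinearOrder.lift' key hkey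
  refine ⟨ord, fun g u v huv ↦ ?_⟩
  have huv' : key u < key v := huv
  change key (g * u * g⁻¹) < key (g * v * g⁻¹)
  obtain ⟨i, hlt, hi⟩ := huv'
  have hD : (magnus v).val - (magnus u).val ∈ lengthFiltration α (ofLex i).1 := by
    refine hmem _ _ (lengthFiltration_succ_le 0 (hdiff v u)) fun j hj ↦ ?_
    rw [hentry_sub, sub_eq_zero]
    refine (hlt j ?_).symm
    exact Prod.Lex.lt_iff.mpr (Or.inl hj)
  have hconj := magnus_conj_sub_mem hD g
  have hcomp : ∀ j, (ofLex j).1 ≤ (ofLex i).1 →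
      entry (magnus (g * v * g⁻¹)).val j - entry (magnus (g * u * g⁻¹)).val j =
        entry (magnus v).val j - entry (magnus u).val j := by
    intro j hj
    have := hentry_zero _ _ hconj j hj
    rw [hentry_sub, sub_eq_zero] at this
    rw [← hentry_sub, ← hentry_sub, ← this]
    congr 1
    simp only [_root_.map_mul, Units.val_mul]
    noncomm_ring
  refine ⟨i, fun j hj ↦ ?_, ?_⟩
  · have hj1 : (ofLex j).1 ≤ (ofLex i).1 := by
      rcases Prod.Lex.lt_iff.mp hj with h | h
      · exact h.le
      · exact h.1.le
    have h1 := hcomp j hj1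
    have h2 : entry (magnus u).val j = entry (magnus v).val j := hlt j hj
    change entry (magnus (g * u * g⁻¹)).val j = entry (magnus (g * v * g⁻¹)).val j
    linarith
  · have h1 := hcomp i le_rfl
    have h2 : entry (magnus u).val i < entry (magnus v).val i := hi
    change entry (magnus (g * u * g⁻¹)).val i < entry (magnus (g * v * g⁻¹)).val i
    linarith

end Magnus

section Potential

variable {α : Type*}

theorem exists_potential {A : Type*} [AddCommGroup A] (φ : FreeGroup α → α → A) :
    ∃ P : FreeGroup α → A, P 1 = 0 ∧ ∀ g e, P (g * of e) = P g + φ g e := by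
  let σ : α → Equiv.Perm (FreeGroup α × A) := fun e ↦
    { toFun := fun s ↦ (s.1 * of e, s.2 + φ s.1 e)
      invFun := fun s ↦ (s.1 * (of e)⁻¹, s.2 - φ (s.1 * (of e)⁻¹) e)
      left_inv := fun s ↦ by simp
      right_inv := fun s ↦ by simp }
  let Φ : FreeGroup α →* Equiv.Perm (FreeGroup α × A) := FreeGroup.lift fun e ↦ (σ e)⁻¹
  have hstep : ∀ g e, (Φ (g * of e))⁻¹ (1, 0) = σ e ((Φ g)⁻¹ (1, 0)) := by
    intro g e
    rw [_root_.map_mul, mul_inv_rev, Equiv.Perm.mul_apply]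
    simp [Φ]
  have hfst : ∀ g s, ((Φ g)⁻¹ s).1 = s.1 * g := by
    intro g
    induction g using FreeGroup.induction_on with
    | C1 => simp
    | of e => simp [Φ, σ]
    | inv_of e _ =>
      intro s
      have : (Φ (of e)⁻¹)⁻¹ = (σ e)⁻¹ := by simp [Φ]
      rw [this]
      rfl
    | mul g h hg hh =>
      intro s
      rw [_root_.map_mul, mul_inv_rev, Equiv.Perm.mul_apply, hh, hg, mul_assoc]
  refine ⟨fun g ↦ ((Φ g)⁻¹ (1, 0)).2, by simp, fun g e ↦ ?_⟩
  simp only [hstep]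
  change ((Φ g)⁻¹ (1, 0)).2 + φ ((Φ g)⁻¹ (1, 0)).1 e = _
  rw [hfst, one_mul]

theorem potential_ext {A : Type*} [AddCommGroup A] {P Q : FreeGroup α → A} (h1 : P 1 = Q 1)
    (h : ∀ g e, P (g * of e) - P g = Q (g * of e) - Q g) (g : FreeGroup α) : P g = Q g := by
  suffices ∀ u v : FreeGroup α, P u = Q u → P (u * v) = Q (u * v) by simpa using this 1 g h1
  intro u v
  induction v using FreeGroup.induction_on generalizing u with
  | C1 => simp
  | of e =>
    intro hu
    have := h u e
    rw [hu] at this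
    exact sub_left_injective this
  | inv_of e _ =>
    intro hu
    have := h (u * (of e)⁻¹) e
    rw [inv_mul_cancel_right, hu] at this
    exact sub_right_injective this
  | mul v w hv hw =>
    intro hu
    rw [← mul_assoc]
    exact hw _ (hv _ hu)

theorem potential_mul_left {R : Type*} [Ring R] {P : FreeGroup α → R} {φ : FreeGroup α → α → R}
    (hP1 : P 1 = 0) (hP : ∀ g e, P (g * of e) = P g + φ g e) {h : FreeGroup α} {c : R}
    (hφ : ∀ g e, φ (h * g) e = c * φ g e) (g : FreeGroup α) : P (h * g) = P h + c * P g := by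
  refine potential_ext (P := fun g ↦ P (h * g)) (Q := fun g ↦ P h + c * P g) (by simp [hP1])
    (fun g e ↦ ?_) g
  simp only [← mul_assoc, hP, hφ]
  noncomm_ring

/-- The right coset of `g`, represented as the left coset of its inverse. -/
def vertex (H : Subgroup (FreeGroup α)) (g : FreeGroup α) : FreeGroup α ⧸ H := ↑g⁻¹

variable {H : Subgroup (FreeGroup α)}

theorem vertex_eq_vertex {g h : FreeGroup α} : vertex H g = vertex H h ↔ g * h⁻¹ ∈ H := by
  rw [vertex, vertex, QuotientGroup.eq, inv_inv]

theorem vertex_mul_left {h : FreeGroup α} (hh : h ∈ H) (g : FreeGroup α) :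
    vertex H (h * g) = vertex H g := by
  rw [vertex_eq_vertex, mul_inv_cancel_right]
  exact hh

theorem vertex_mul_right_inj {g h : FreeGroup α} (u : FreeGroup α) :
    vertex H (g * u) = vertex H (h * u) ↔ vertex H g = vertex H h := by
  rw [vertex_eq_vertex, vertex_eq_vertex, mul_inv_rev, ← mul_assoc, mul_inv_cancel_right]

theorem vertex_surjective (H : Subgroup (FreeGroup α)) : Function.Surjective (vertex H) :=
  fun w ↦ ⟨w.out⁻¹, by simp [vertex]⟩

/-- A finite subgraph of the Schreier graph of a two-generated subgroup, containing the base point,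
has at most one edge more than it has vertices. -/
theorem ncard_edges_le {x y : FreeGroup α} (hH : H = Subgroup.closure {x, y})
    {V : Set (FreeGroup α ⧸ H)} {E : Set ((FreeGroup α ⧸ H) × α)} (hV : V.Finite) (hE : E.Finite)
    (h1 : vertex _ 1 ∈ V)
    (hends : ∀ g e, (vertex _ g, e) ∈ E → vertex _ g ∈ V ∧ vertex _ (g * of e) ∈ V) :
    E.ncard ≤ V.ncard + 1 := by
  classical
  let φ : (E → ZMod 2) → FreeGroup α → α → ZMod 2 := fun s g e ↦
    if h : (vertex H g, e) ∈ E then s ⟨_, h⟩ else 0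
  choose P hP1 hP using fun s ↦ exists_potential (φ s)
  have hPH : ∀ s, ∀ h ∈ H, ∀ g, P s (h * g) = P s h + P s g := by
    intro s h hh g
    rw [potential_mul_left (c := 1) (hP1 s) (hP s) _ g, one_mul]
    intro g e
    simp only [φ, vertex_mul_left hh, one_mul]
  let V₀ := V \ {vertex H 1}
  have : Finite E := hE
  have : Finite V₀ := hV.subset Set.sdiff_subset
  let Φ : (E → ZMod 2) → (Fin 2 ⊕ V₀ → ZMod 2) := fun s ↦
    Sum.elim ![P s x, P s y] fun w ↦ P s (Function.surjInv (vertex_surjective H) w.1)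
  have hΦ : Function.Injective Φ := by
    intro s t hst
    have hx : P s x = P t x := congrFun hst (Sum.inl 0)
    have hy : P s y = P t y := congrFun hst (Sum.inl 1)
    have hD : ∀ h ∈ H, P s h = P t h := by
      intro h hh
      rw [hH] at hh
      induction hh using Subgroup.closure_induction with
      | mem u hu => rcases hu with rfl | rfl <;> assumption
      | one => rw [hP1, hP1]
      | mul u v hu hv hu' hv' =>
        rw [← hH] at hu hv
        rw [hPH s u hu, hPH t u hu, hu', hv']
      | inv u hu hu' =>
        rw [← hH] at hu
        have h1 := hPH s u hu u⁻¹
        have h2 := hPH t u hu u⁻¹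
        rw [mul_inv_cancel, hP1] at h1 h2
        rw [h1, hu'] at h2
        exact add_left_cancel h2
    have hrep : ∀ g r, vertex H g = vertex H r → P s r = P t r → P s g = P t g := by
      intro g r hgr hr
      have hmem := vertex_eq_vertex.mp hgr
      rw [← inv_mul_cancel_right g r, hPH s _ hmem, hPH t _ hmem, hD _ hmem, hr]
    have hV' : ∀ g, vertex H g ∈ V → P s g = P t g := by
      intro g hg
      by_cases hg1 : vertex H g = vertex H 1
      · exact hrep g 1 hg1 (by rw [hP1, hP1])
      · refine hrep g (Function.surjInv (vertex_surjective H) (vertex H g))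
          (Function.surjInv_eq _ _).symm ?_
        exact congrFun hst (Sum.inr ⟨vertex H g, hg, hg1⟩)
    funext ⟨⟨w, e⟩, hw⟩
    obtain ⟨g, rfl⟩ := vertex_surjective H w
    obtain ⟨hg, hge⟩ := hends g e hw
    have h2 := hV' _ hge
    rw [hP, hP, hV' g hg] at h2
    have h3 := add_left_cancel h2
    simpa [φ, hw] using h3
  have hcard := Nat.card_le_card_of_injective Φ hΦ
  rw [Nat.card_fun, Nat.card_fun, Nat.card_sum, Nat.card_zmod, Nat.card_fin,
    Nat.pow_le_pow_iff_right (by norm_num), Nat.card_coe_set_eq, Nat.card_coe_set_eq] at hcard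
  have := Set.ncard_sdiff_singleton_add_one h1 hV
  change E.ncard ≤ 2 + (V \ {vertex H 1}).ncard at hcard
  omega

theorem closure_pair_subtype {G : Type*} [Group G] (x y : G) :
    Subgroup.closure {(⟨x, Subgroup.subset_closure (by simp)⟩ : Subgroup.closure {x, y}),
      ⟨y, Subgroup.subset_closure (by simp)⟩} = ⊤ := by
  rw [← Subgroup.closure_closure_coe_preimage (k := {x, y})]
  congr 1
  ext ⟨u, hu⟩
  simp

/-- A function on the free group invariant under `x ^ a * y ^ b` that varies along a single edge
of the Schreier graph of the subgroup generated by `x` and `y`. -/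
theorem exists_function_varying_along_edge {x y : FreeGroup α} (hxy : ¬ Commute x y) {a b : ℕ}
    (ha : 2 ≤ a) (hb : 2 ≤ b) (u : FreeGroup α) (e : α) :
    ∃ (K : Type) (P : FreeGroup α → K), (∀ g, P (x ^ a * y ^ b * g) = P g) ∧
      ∀ g e', P (g * of e') = P g ↔
        ¬ (vertex (Subgroup.closure {x, y}) g = vertex _ u ∧ e' = e) := by
  classical
  set H := Subgroup.closure {x, y} with hH
  have hxH : x ∈ H := Subgroup.subset_closure (by simp)
  have hyH : y ∈ H := Subgroup.subset_closure (by simp)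
  obtain ⟨p, hp, γ, hγ⟩ := exists_prime_unit_orderOf (N := a * b) (by positivity)
  have : Fact p.Prime := ⟨hp⟩
  obtain ⟨ψ, hψx, hψy⟩ := exists_hom_of_closure_pair (x := (⟨x, hxH⟩ : H)) (y := ⟨y, hyH⟩)
    (fun h ↦ hxy (h.map H.subtype)) (closure_pair_subtype x y) (γ ^ b) (γ ^ a)
  have hxa : (γ ^ b) ^ a = 1 := by
    rw [← pow_mul, ← orderOf_dvd_iff_pow_eq_one, hγ, mul_comm]
  have hyb : (γ ^ a) ^ b = 1 := by
    rw [← pow_mul, ← orderOf_dvd_iff_pow_eq_one, hγ]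
  have hx1 : γ ^ b ≠ 1 := by
    rw [Ne, ← orderOf_dvd_iff_pow_eq_one, hγ]
    exact Nat.not_dvd_of_pos_of_lt (by omega) (by nlinarith)
  have hy1 : γ ^ a ≠ 1 := by
    rw [Ne, ← orderOf_dvd_iff_pow_eq_one, hγ]
    exact Nat.not_dvd_of_pos_of_lt (by omega) (by nlinarith)
  let φ : FreeGroup α → α → ZMod p := fun g e' ↦
    if h : g * u⁻¹ ∈ H ∧ e' = e then ψ ⟨g * u⁻¹, h.1⟩ else 0
  obtain ⟨P, hP1, hP⟩ := exists_potential φ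
  have hφ : ∀ h : H, ∀ g e', φ (h * g) e' = ψ h * φ g e' := by
    intro h g e'
    have hiff : (↑h * g) * u⁻¹ ∈ H ↔ g * u⁻¹ ∈ H := by
      rw [mul_assoc]
      exact Subgroup.mul_mem_cancel_left _ h.2
    simp only [φ, hiff]
    split_ifs with hc
    · rw [← Units.val_mul, ← _root_.map_mul]
      congr 2
      exact Subtype.ext (mul_assoc _ _ _)
    · simp
  have hPH : ∀ h : H, ∀ g, P (h * g) = P h + ψ h * P g := fun h g ↦
    potential_mul_left hP1 hP (hφ h) g
  have hpow : ∀ h : H, ψ h ≠ 1 → ∀ m : ℕ, ψ h ^ m = 1 → P (h ^ m : H) = 0 := by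
    intro h hne m hm
    have hgeom : ∀ m : ℕ, ((ψ h : ZMod p) - 1) * P (h ^ m : H) = (ψ h ^ m - 1) * P h := by
      intro m
      induction m with
      | zero => simp [hP1]
      | succ m ih =>
        rw [pow_succ', Subgroup.coe_mul, hPH, pow_succ']
        linear_combination (ψ h : ZMod p) * ih
    have h0 := hgeom m
    rw [← Units.val_pow_eq_pow_val, hm, Units.val_one, sub_self, zero_mul] at h0
    refine (mul_eq_zero.mp h0).resolve_left ?_
    exact fun h ↦ hne (Units.ext (sub_eq_zero.mp h))
  have hPx := hpow ⟨x, hxH⟩ (by rwa [hψx]) a (by rwa [hψx])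
  have hPy := hpow ⟨y, hyH⟩ (by rwa [hψy]) b (by rwa [hψy])
  refine ⟨ZMod p, P, fun g ↦ ?_, fun g e' ↦ ?_⟩
  · have h1 := hPH (⟨x, hxH⟩ ^ a) (y ^ b * g)
    have h2 := hPH (⟨y, hyH⟩ ^ b) g
    rw [hPx, _root_.map_pow, hψx, hxa] at h1
    rw [hPy, _root_.map_pow, hψy, hyb] at h2
    simp only [SubgroupClass.coe_pow, Units.val_one, one_mul, zero_add] at h1 h2
    rw [mul_assoc, h1, h2]
  · rw [hP, add_eq_left, vertex_eq_vertex]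
    simp only [φ]
    split_ifs with hc
    · simp [hc]
    · simp only [true_iff]
      exact hc

end Potential

section Walk

variable {α : Type*}

/-- The product of the first letters of an infinite word. -/
def walk (l : ℕ → α × Bool) : ℕ → FreeGroup α
  | 0 => 1
  | j + 1 => walk l j * mk [l j]

variable {l : ℕ → α × Bool} {n : ℕ}

theorem walk_zero (l : ℕ → α × Bool) : walk l 0 = 1 := rfl

theorem walk_succ (l : ℕ → α × Bool) (j : ℕ) : walk l (j + 1) = walk l j * mk [l j] := rfl

theorem walk_add_eq_mul_mk (l : ℕ → α × Bool) (j m : ℕ) :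
    walk l (j + m) = walk l j * mk ((List.range m).map fun k ↦ l (j + k)) := by
  induction m with
  | zero => simp [← one_eq_mk]
  | succ m ih =>
    rw [← add_assoc, walk_succ, ih, List.range_succ, List.map_append, ← mul_mk, mul_assoc]
    rfl

theorem walk_add_of_periodic (hl : Function.Periodic l n) (j : ℕ) :
    walk l (n + j) = walk l n * walk l j := by
  induction j with
  | zero => simp [walk_zero]
  | succ j ih => rw [← add_assoc, walk_succ, walk_succ, ih, add_comm n j, hl, mul_assoc]

theorem walk_mul_of_periodic (hl : Function.Periodic l n) (m : ℕ) :
    walk l (m * n) = walk l n ^ m := by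
  induction m with
  | zero => simp [walk_zero]
  | succ m ih => rw [add_mul, one_mul, add_comm, walk_add_of_periodic hl, pow_succ', ih]

/-- The conjugate of the period of a periodic word by its initial segment of length `j`. -/
def rotation (l : ℕ → α × Bool) (n j : ℕ) : FreeGroup α := (walk l j)⁻¹ * walk l n * walk l j

theorem rotation_succ (l : ℕ → α × Bool) (n j : ℕ) :
    rotation l n (j + 1) = (mk [l j])⁻¹ * rotation l n j * mk [l j] := by
  simp only [rotation, walk_succ, mul_inv_rev, mul_assoc]

theorem rotation_eq_mk (hl : Function.Periodic l n) (j : ℕ) :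
    rotation l n j = mk ((List.range n).map fun k ↦ l (j + k)) := by
  rw [rotation, mul_assoc, ← walk_add_of_periodic hl, add_comm, walk_add_eq_mul_mk,
    inv_mul_cancel_left]

theorem isReduced_map_range (hred : ∀ j, (l j).1 = (l (j + 1)).1 → (l j).2 = (l (j + 1)).2)
    (j m : ℕ) : IsReduced ((List.range m).map fun k ↦ l (j + k)) := by
  rw [IsReduced, List.isChain_map, List.isChain_range]
  exact fun k _ ↦ hred (j + k)

theorem modEq_of_rotation_eq (hn : 0 < n) (hl : Function.Periodic l n)
    (hmin : ∀ d, Function.Periodic l d → n ∣ d)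
    (hred : ∀ j, (l j).1 = (l (j + 1)).1 → (l j).2 = (l (j + 1)).2) {i j : ℕ}
    (h : rotation l n i = rotation l n j) : i ≡ j [MOD n] := by
  classical
  wlog hij : i ≤ j generalizing i j
  · exact (this h.symm (le_of_not_ge hij)).symm
  have hlist : (List.range n).map (fun k ↦ l (i + k)) = (List.range n).map fun k ↦ l (j + k) := by
    rw [← (isReduced_map_range hred i n).reduce_eq, ← (isReduced_map_range hred j n).reduce_eq,
      ← toWord_mk, ← toWord_mk, ← rotation_eq_mk hl, ← rotation_eq_mk hl, h]
  have hshift : ∀ k, l (i + k) = l (j + k) := by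
    intro k
    have h1 := List.map_inj_left.mp hlist (k % n) (by simpa using Nat.mod_lt k hn)
    rw [← hl.map_mod_nat (i + k), ← hl.map_mod_nat (j + k), ← Nat.add_mod_mod i,
      ← Nat.add_mod_mod j, hl.map_mod_nat, hl.map_mod_nat]
    exact h1
  refine (Nat.modEq_iff_dvd' hij).mpr (hmin _ fun k ↦ ?_)
  obtain ⟨q, hq1, -, hq : q ≡ k [MOD n]⟩ :=
    Function.Periodic.exists_mem_Ico_nat (f := (· % n)) (fun m ↦ Nat.add_mod_right m n) hn i k
  have hmod : ∀ {s t}, s ≡ t [MOD n] → l s = l t := fun {s t} hst ↦ by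
    rw [← hl.map_mod_nat s, ← hl.map_mod_nat t, hst]
  rw [← hmod (hq.add_right (j - i)), ← hmod hq]
  have := hshift (q - i)
  rw [Nat.add_sub_cancel' hq1] at this
  rw [this]
  congr 1
  omega

theorem mk_singleton_true (e : α) : mk [(e, true)] = of e := rfl

theorem mk_singleton_false (e : α) : mk [(e, false)] = (of e)⁻¹ := rfl

/-- The edge of the Schreier graph of `H` traversed by the `j`-th letter. -/
def edge (H : Subgroup (FreeGroup α)) (l : ℕ → α × Bool) (j : ℕ) : (FreeGroup α ⧸ H) × α :=
  (vertex H (if (l j).2 then walk l j else walk l (j + 1)), (l j).1)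

variable {H : Subgroup (FreeGroup α)}

theorem ends_mem_of_edge {g : FreeGroup α} {e : α} {j : ℕ} (h : edge H l j = (vertex H g, e)) :
    vertex H g ∈ Set.range (fun j ↦ vertex H (walk l j)) ∧
      vertex H (g * of e) ∈ Set.range fun j ↦ vertex H (walk l j) := by
  obtain ⟨h1, rfl⟩ := Prod.ext_iff.mp h
  change vertex H (if (l j).2 then walk l j else walk l (j + 1)) = vertex H g at h1
  change _ ∧ vertex H (g * of (l j).1) ∈ _
  refine ⟨?_, ?_⟩
  · rw [← h1]
    split_ifs
    exacts [⟨j, rfl⟩, ⟨j + 1, rfl⟩]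
  rw [← vertex_mul_right_inj (of (l j).1)] at h1
  rw [← h1]
  have hs := walk_succ l j
  rcases hlj : l j with ⟨e, _ | _⟩ <;> rw [hlj] at hs
  · rw [mk_singleton_false] at hs
    exact ⟨j, by simp [hs]⟩
  · rw [mk_singleton_true] at hs
    exact ⟨j + 1, by simp [hs]⟩

theorem edge_eq_edge {i j : ℕ} (h : edge H l i = edge H l j) :
    (l i = l j ∧ vertex H (walk l i) = vertex H (walk l j) ∧
        vertex H (walk l (i + 1)) = vertex H (walk l (j + 1))) ∨
      ((l i).1 = (l j).1 ∧ (l i).2 ≠ (l j).2 ∧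
        vertex H (walk l i) = vertex H (walk l (j + 1)) ∧
        vertex H (walk l (i + 1)) = vertex H (walk l j)) := by
  have hi := walk_succ l i
  have hj := walk_succ l j
  obtain ⟨h1, h2⟩ := Prod.ext_iff.mp h
  simp only [edge] at h1 h2
  rcases hli : l i with ⟨e, _ | _⟩ <;> rcases hlj : l j with ⟨e', _ | _⟩ <;>
    rw [hli] at hi h1 h2 <;> rw [hlj] at hj h1 h2 <;> obtain rfl : e = e' := h2 <;>
    simp only [if_true, Bool.false_eq_true, if_false] at h1
  · exact Or.inl ⟨rfl, by rwa [hi, hj, vertex_mul_right_inj] at h1, h1⟩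
  · refine Or.inr ⟨rfl, by simp, ?_, h1⟩
    rwa [← vertex_mul_right_inj (mk [(e, true)]), ← hj, hi, mk_singleton_true, mk_singleton_false,
      inv_mul_cancel_right] at h1
  · refine Or.inr ⟨rfl, by simp, h1, ?_⟩
    rwa [← vertex_mul_right_inj (mk [(e, true)]), ← hi, hj, mk_singleton_true, mk_singleton_false,
      inv_mul_cancel_right] at h1
  · exact Or.inl ⟨rfl, h1, by rwa [hi, hj, vertex_mul_right_inj]⟩

theorem walk_step_eq_iff {K : Type*} (P : FreeGroup α → K) (S : FreeGroup α ⧸ H → α → Prop)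
    (hP : ∀ g e, P (g * of e) = P g ↔ ¬ S (vertex H g) e) (j : ℕ) :
    P (walk l (j + 1)) = P (walk l j) ↔ ¬ S (edge H l j).1 (edge H l j).2 := by
  have hs := walk_succ l j
  simp only [edge]
  rcases hlj : l j with ⟨e, _ | _⟩ <;> rw [hlj] at hs
  · rw [mk_singleton_false] at hs
    have := hP (walk l (j + 1)) e
    rw [hs, inv_mul_cancel_right] at this
    simp only [Bool.false_eq_true, if_false]
    rw [hs, eq_comm]
    exact this
  · rw [mk_singleton_true] at hs
    rw [hs]
    exact hP (walk l j) e

/-- If all powers of the period of a periodic word lying in the subgroup generated by `x` and `y`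
are powers of `x ^ a * y ^ b`, then the associated closed walk visits every vertex twice. -/
theorem exists_vertex_walk_eq {x y : FreeGroup α} (hxy : ¬ Commute x y) {a b C : ℕ} (ha : 2 ≤ a)
    (hb : 2 ≤ b) (hn : 0 < n) (hC : 0 < C) (hl : Function.Periodic l n)
    (hred : ∀ j, (l j).1 = (l (j + 1)).1 → (l j).2 = (l (j + 1)).2)
    (hpow : walk l n ^ C = x ^ a * y ^ b) (hH : H = Subgroup.closure {x, y}) (j : ℕ) :
    ∃ i, ¬ i ≡ j [MOD C * n] ∧ vertex H (walk l i) = vertex H (walk l j) := by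
  subst hH
  set H := Subgroup.closure {x, y} with hH
  by_contra! hcon
  have hNpos : 0 < C * n := Nat.mul_pos hC hn
  have hlN : Function.Periodic l (C * n) := hl.nat_mul C
  obtain ⟨K, P, hinv, hP⟩ := exists_function_varying_along_edge hxy ha hb
    (if (l j).2 then walk l j else walk l (j + 1)) (l j).1
  have hstep : ∀ i, P (walk l (i + 1)) = P (walk l i) ↔ edge H l i ≠ edge H l j := by
    intro i
    rw [walk_step_eq_iff P (fun w e ↦ w = (edge H l j).1 ∧ e = (edge H l j).2) hP, Ne,
      Prod.ext_iff]
  have hlast : P (walk l (j + C * n)) = P (walk l j) := by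
    rw [add_comm, walk_add_of_periodic hlN, walk_mul_of_periodic hl, hpow, hinv]
  have hfirst : P (walk l (j + 1)) ≠ P (walk l j) := fun h ↦ (hstep j).mp h rfl
  refine hfirst ?_
  rw [← hlast]
  have hconst : ∀ d, d + 1 ≤ C * n → P (walk l (j + 1 + d)) = P (walk l (j + 1)) := by
    intro d
    induction d with
    | zero => exact fun _ ↦ rfl
    | succ d ih =>
      intro hd
      rw [← ih (by omega), ← add_assoc, hstep]
      intro hedge
      rcases edge_eq_edge hedge with ⟨-, h, -⟩ | ⟨h1, h2, -, h⟩
      · by_contra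
        refine hcon _ (fun hmod ↦ ?_) h
        have := (Nat.modEq_iff_dvd' (by omega)).mp hmod.symm
        have := Nat.eq_zero_of_dvd_of_lt this (by omega)
        omega
      · have hmod : j + 1 + d + 1 ≡ j [MOD C * n] := by
          by_contra hmod
          exact hcon _ hmod h
        have hlet : l (j + 1 + d + 1) = l j := by
          rw [← hlN.map_mod_nat, hmod, hlN.map_mod_nat]
        rw [← hlet] at h1 h2
        exact h2 (hred _ h1)
  have := hconst (C * n - 1) (by omega)
  rw [← this]
  congr 2
  omega

theorem walk_pow_ne_of_mem_iff {x y : FreeGroup α} (hxy : ¬ Commute x y) {a b C : ℕ} (ha : 2 ≤ a)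
    (hb : 2 ≤ b) (hC : 2 ≤ C) (hn : 0 < n) (hl : Function.Periodic l n)
    (hmin : ∀ d, Function.Periodic l d → n ∣ d)
    (hred : ∀ j, (l j).1 = (l (j + 1)).1 → (l j).2 = (l (j + 1)).2)
    (hH : H = Subgroup.closure {x, y}) (hmem : ∀ i, walk l n ^ i ∈ H ↔ C ∣ i) :
    walk l n ^ C ≠ x ^ a * y ^ b := by
  intro hpow
  have hNpos : 0 < C * n := by positivity
  have hlN : Function.Periodic l (C * n) := hl.nat_mul C
  have hlmod : ∀ {s t}, s ≡ t [MOD C * n] → l s = l t := fun {s t} hst ↦ by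
    rw [← hlN.map_mod_nat s, ← hlN.map_mod_nat t, hst]
  have hv : Function.Periodic (fun j ↦ vertex H (walk l j)) (C * n) := by
    intro j
    simp only
    rw [add_comm, walk_add_of_periodic hlN, walk_mul_of_periodic hl]
    exact vertex_mul_left ((hmem C).mpr dvd_rfl) _
  have hε : Function.Periodic (edge H l) (C * n) := by
    intro j
    have h1 := hv j
    have h2 := hv (j + 1)
    simp only at h1 h2
    simp only [edge, hlN j]
    split_ifs
    · rw [h1]
    · rw [← h2, add_right_comm]
  have hη : Function.Periodic (rotation l n) n := by
    intro j
    rw [rotation_eq_mk hl, rotation_eq_mk hl]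
    refine congrArg mk (List.map_congr_left fun k _ ↦ ?_)
    rw [add_right_comm, hl]
  have hsep : ∀ i j, vertex H (walk l i) = vertex H (walk l j) →
      rotation l n i = rotation l n j → i ≡ j [MOD C * n] := by
    intro i j h1 h2
    wlog hij : j ≤ i generalizing i j
    · exact (this j i h1.symm h2.symm (le_of_not_ge hij)).symm
    obtain ⟨d, hd⟩ := (Nat.modEq_iff_dvd' hij).mp (modEq_of_rotation_eq hn hl hmin hred h2).symm
    have hi : i = d * n + j := by rw [mul_comm, ← hd]; omega
    have hld : Function.Periodic l (d * n) := hl.nat_mul d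
    rw [vertex_eq_vertex, hi, walk_add_of_periodic hld, mul_inv_cancel_right,
      walk_mul_of_periodic hl, hmem] at h1
    refine ((Nat.modEq_iff_dvd' hij).mpr ?_).symm
    rw [hd, mul_comm]
    exact Nat.mul_dvd_mul_left n h1
  obtain ⟨_, hord⟩ := exists_linearOrder_conj_lt α
  have hord_iff : ∀ g u v : FreeGroup α, u < v ↔ g * u * g⁻¹ < g * v * g⁻¹ := by
    refine fun g u v ↦ ⟨hord g u v, fun h ↦ ?_⟩
    have := hord g⁻¹ _ _ h
    simpa [mul_assoc] using this
  have hcount := ncard_range_add_le_ncard_range (ε := edge H l) hn (by omega) hv hε hη hsep ?_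
    (exists_vertex_walk_eq hxy ha hb hn (by omega) hl hred hpow hH)
  · have hfin : ∀ {β : Type _} {f : ℕ → β}, Function.Periodic f (C * n) →
        (Set.range f).Finite := by
      intro β f hf
      refine ((Finset.range (C * n)).finite_toSet.image f).subset ?_
      rintro _ ⟨j, rfl⟩
      exact ⟨j % (C * n), by simpa using Nat.mod_lt j hNpos, hf.map_mod_nat j⟩
    have := ncard_edges_le hH (hfin hv) (hfin hε) ⟨0, rfl⟩ fun g e ⟨j, hj⟩ ↦ ends_mem_of_edge hj
    omega
  · intro i j hij
    rcases edge_eq_edge hij with ⟨h1, h2, h3⟩ | ⟨h1, h2, h3, h4⟩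
    · refine Or.inl ⟨h2, h3, ?_, ?_⟩
      · rw [rotation_succ, rotation_succ, h1, hord_iff (mk [l j])⁻¹, inv_inv]
      · rw [rotation_succ, rotation_succ, h1, hord_iff (mk [l j])⁻¹, inv_inv]
    · have hinv : mk [l i] = (mk [l j])⁻¹ := by
        rcases hli : l i with ⟨e, _ | _⟩ <;> rcases hlj : l j with ⟨e', _ | _⟩ <;>
          simp_all [inv_mk, invRev]
      have h5 : rotation l n (j + 1) = (mk [l j])⁻¹ * rotation l n j * mk [l j] :=
        rotation_succ l n j
      have h6 : rotation l n (i + 1) = mk [l j] * rotation l n i * (mk [l j])⁻¹ := by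
        rw [rotation_succ, hinv, inv_inv]
      have h7 : mk [l j] * rotation l n (j + 1) * (mk [l j])⁻¹ = rotation l n j := by
        rw [h5]
        group
      refine Or.inr ⟨h3, h4, ?_, ?_, fun hmod ↦ ?_⟩
      · rw [h6, hord_iff (mk [l j]), h7]
      · rw [h6, hord_iff (mk [l j]), h7]
      · rw [hlmod hmod] at h1 h2
        exact h2 (hred j h1.symm).symm

theorem walk_pow_ne {x y : FreeGroup α} (hxy : ¬ Commute x y) {a b C : ℕ} (ha : 2 ≤ a)
    (hb : 2 ≤ b) (hC : 2 ≤ C) (hn : 0 < n) (hl : Function.Periodic l n)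
    (hmin : ∀ d, Function.Periodic l d → n ∣ d)
    (hred : ∀ j, (l j).1 = (l (j + 1)).1 → (l j).2 = (l (j + 1)).2) :
    walk l n ^ C ≠ x ^ a * y ^ b := by
  classical
  intro hpow
  have hxH : x ∈ Subgroup.closure {x, y} := Subgroup.subset_closure (by simp)
  have hyH : y ∈ Subgroup.closure {x, y} := Subgroup.subset_closure (by simp)
  have hCmem : walk l n ^ C ∈ Subgroup.closure {x, y} := by
    rw [hpow]
    exact mul_mem (pow_mem hxH a) (pow_mem hyH b)
  have hex : ∃ c, 0 < c ∧ walk l n ^ c ∈ Subgroup.closure {x, y} := ⟨C, by omega, hCmem⟩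
  obtain ⟨c, ⟨hc, hcmem⟩, hcmin⟩ : ∃ c, (0 < c ∧ walk l n ^ c ∈ Subgroup.closure {x, y}) ∧
      ∀ d < c, ¬ (0 < d ∧ walk l n ^ d ∈ Subgroup.closure {x, y}) :=
    ⟨Nat.find hex, Nat.find_spec hex, fun _ ↦ Nat.find_min hex⟩
  have hdvd : ∀ i, walk l n ^ i ∈ Subgroup.closure {x, y} ↔ c ∣ i := by
    refine fun i ↦ ⟨fun hi ↦ ?_, ?_⟩
    · have hr := hcmin (i % c) (Nat.mod_lt i hc)
      rw [← Nat.mod_add_div i c, pow_add, pow_mul,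
        Subgroup.mul_mem_cancel_right _ (pow_mem hcmem _)] at hi
      exact Nat.dvd_of_mod_eq_zero (by_contra fun h ↦ hr ⟨Nat.pos_of_ne_zero h, hi⟩)
    · rintro ⟨k, rfl⟩
      rw [pow_mul]
      exact pow_mem hcmem k
  obtain ⟨k, rfl⟩ := (hdvd C).mp hCmem
  by_cases hk : 2 ≤ k
  · refine not_isPow_pow_mul_pow (x := (⟨x, hxH⟩ : Subgroup.closure {x, y})) (y := ⟨y, hyH⟩)
      (q := ⟨_, hcmem⟩) (fun h ↦ hxy (h.map (Subgroup.subtype _))) (closure_pair_subtype x y)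
      (a := a) (b := b) (by omega) (by omega) hk (Subtype.ext ?_)
    simpa [pow_mul] using hpow
  · obtain rfl : k = 1 := by
      have : k ≠ 0 := by rintro rfl; simp at hC
      omega
    rw [mul_one] at hpow hC
    exact walk_pow_ne_of_mem_iff hxy ha hb hC hn hl hmin hred rfl hdvd hpow

/-- Every nontrivial element of a free group is conjugate to a positive power of the period of a
periodic reduced word. -/
theorem exists_conj_walk_pow {z : FreeGroup α} (hz : z ≠ 1) :
    ∃ (l : ℕ → α × Bool) (n m : ℕ) (u : FreeGroup α), 0 < n ∧ 0 < m ∧ Function.Periodic l n ∧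
      (∀ d, Function.Periodic l d → n ∣ d) ∧
      (∀ j, (l j).1 = (l (j + 1)).1 → (l j).2 = (l (j + 1)).2) ∧
      z = u * walk l n ^ m * u⁻¹ := by
  classical
  set L := reduceCyclically z.toWord with hL
  set u : FreeGroup α := mk (reduceCyclically.conjugator z.toWord) with hu
  have hzL : z = u * mk L * u⁻¹ := by
    rw [hu, inv_mk, mul_mk, mul_mk, hL,
      reduceCyclically.conj_conjugator_reduceCyclically, mk_toWord]
  have hcyc : IsCyclicallyReduced L := reduceCyclically.isCyclicallyReduced isReduced_toWord
  have hlen : 0 < L.length := by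
    rw [List.length_pos_iff]
    intro h
    rw [h, ← one_eq_mk] at hzL
    exact hz (by simpa using hzL)
  let l : ℕ → α × Bool := fun j ↦ L[j % L.length]'(Nat.mod_lt j hlen)
  have hlL : Function.Periodic l L.length := fun j ↦ by simp [l]
  have hred : ∀ j, (l j).1 = (l (j + 1)).1 → (l j).2 = (l (j + 1)).2 := by
    intro j
    have hj := Nat.mod_lt j hlen
    rcases Nat.lt_or_ge (j % L.length + 1) L.length with h | h
    · have h1 : (j + 1) % L.length = j % L.length + 1 := by
        rw [← Nat.mod_add_mod, Nat.mod_eq_of_lt h]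
      have := (List.isChain_iff_getElem.mp hcyc.1) (j % L.length) h
      simpa only [l, h1] using this
    · have h0 : j % L.length + 1 = L.length := by omega
      have h1 : (j + 1) % L.length = 0 := by rw [← Nat.mod_add_mod, h0, Nat.mod_self]
      have h2 : j % L.length = L.length - 1 := by omega
      refine hcyc.2 (l j) ?_ (l (j + 1)) ?_
      · simp only [l, h2, Option.mem_def, List.getLast?_eq_getElem?]
        exact List.getElem?_eq_getElem _
      · simp only [l, h1, Option.mem_def, List.head?_eq_getElem?]
        exact List.getElem?_eq_getElem _
  have hwalk : walk l L.length = mk L := by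
    have := walk_add_eq_mul_mk l 0 L.length
    rw [zero_add, walk_zero, one_mul] at this
    rw [this]
    congr 1
    refine List.ext_getElem (by simp) fun k h1 h2 ↦ ?_
    simp [l, Nat.mod_eq_of_lt h2]
  have hex : ∃ n, 0 < n ∧ Function.Periodic l n := ⟨_, hlen, hlL⟩
  obtain ⟨n, ⟨hn, hln⟩, hnmin⟩ : ∃ n, (0 < n ∧ Function.Periodic l n) ∧
      ∀ d < n, ¬ (0 < d ∧ Function.Periodic l d) :=
    ⟨Nat.find hex, Nat.find_spec hex, fun _ ↦ Nat.find_min hex⟩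
  have hdvd : ∀ d, Function.Periodic l d → n ∣ d := by
    intro d hd
    refine Nat.dvd_of_mod_eq_zero (by_contra fun h ↦
      hnmin (d % n) (Nat.mod_lt d hn) ⟨Nat.pos_of_ne_zero h, fun j ↦ ?_⟩)
    have h1 : l (j + d % n + d / n * n) = l (j + d % n) := hln.nat_mul (d / n) (j + d % n)
    rw [add_assoc, mul_comm, Nat.mod_add_div] at h1
    rw [← h1]
    exact hd j
  obtain ⟨m, hm⟩ := hdvd _ hlL
  refine ⟨l, n, m, u, hn, Nat.pos_of_ne_zero ?_, hln, hdvd, hred, ?_⟩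
  · rintro rfl
    simp [hm] at hlen
  · rw [← walk_mul_of_periodic hln, mul_comm, ← hm, hwalk]
    exact hzL

end Walk

theorem commute_of_pow_eq_pow_mul_pow {α : Type*} {x y z : FreeGroup α} (hz : z ≠ 1) {a b c : ℕ}
    (ha : 2 ≤ a) (hb : 2 ≤ b) (hc : 2 ≤ c) (h : z ^ c = x ^ a * y ^ b) : Commute x y := by
  by_contra hxy
  obtain ⟨l, n, m, u, hn, hm, hl, hmin, hred, rfl⟩ := exists_conj_walk_pow hz
  refine walk_pow_ne (x := u⁻¹ * x * u) (y := u⁻¹ * y * u) (fun hcomm ↦ hxy ?_) ha hb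
    (C := m * c) (by nlinarith) hn hl hmin hred ?_
  · have := hcomm.map (MulAut.conj u).toMonoidHom
    simpa [mul_assoc] using this
  · have h1 := congrArg (fun g ↦ u⁻¹ * g * u) h
    have hconj : ∀ g : FreeGroup α, ∀ k : ℕ, (u⁻¹ * g * u) ^ k = u⁻¹ * g ^ k * u := fun g k ↦ by
      simpa using conj_pow (i := k) (a := u⁻¹) (b := g)
    rw [pow_mul, hconj, hconj]
    simp only [conj_pow] at h1
    simpa [mul_assoc] using h1

theorem exists_mem_zpowers_of_commute {α : Type*} {x y z : FreeGroup α} (hxy : Commute x y)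
    (hxz : Commute x z) (hyz : Commute y z) : ∃ w, x ∈ Subgroup.zpowers w ∧
      y ∈ Subgroup.zpowers w ∧ z ∈ Subgroup.zpowers w := by
  have hcomm : ∀ u ∈ ({x, y, z} : Set (FreeGroup α)), ∀ v ∈ ({x, y, z} : Set (FreeGroup α)),
      u * v = v * u := by
    rintro u (rfl | rfl | rfl) v (rfl | rfl | rfl)
    exacts [rfl, hxy, hxz, hxy.symm, rfl, hyz, hxz.symm, hyz.symm, rfl]
  have := Subgroup.isMulCommutative_closure hcomm
  have := isCyclic_of_commute (Subgroup.closure {x, y, z}) fun u v ↦ mul_comm' u v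
  obtain ⟨⟨w, hw⟩, hgen⟩ := IsCyclic.exists_generator (α := Subgroup.closure {x, y, z})
  have hmem : ∀ g, g ∈ ({x, y, z} : Set (FreeGroup α)) → g ∈ Subgroup.zpowers w := by
    intro g hg
    obtain ⟨k, hk⟩ := hgen ⟨g, Subgroup.subset_closure hg⟩
    exact ⟨k, congrArg Subtype.val hk⟩
  exact ⟨w, hmem x (by simp), hmem y (by simp), hmem z (by simp)⟩

theorem commute_of_commute_pow {α : Type*} {x z : FreeGroup α} {c : ℕ} (hc : c ≠ 0)
    (h : Commute x (z ^ c)) : Commute x z := by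
  have h1 : (x * z * x⁻¹) ^ c = z ^ c := by
    rw [conj_pow, h.eq, mul_inv_cancel_right]
  have h2 := pow_left_injective hc h1
  exact mul_inv_eq_iff_eq_mul.mp h2

end FreeGroup

/-- **Lyndon–Schützenberger.** Let `x, y, z` be nontrivial elements of a free
group.  If `x^a * y^b * z^c = 1` for some integers `a, b, c ≥ 2`, then `x`, `y`,
and `z` are all powers of a single common element. -/
theorem lyndon_schutzenberger {α : Type*} (x y z : FreeGroup α)
    (hx : x ≠ 1) (hy : y ≠ 1) (hz : z ≠ 1)
    (a b c : ℤ) (ha : 2 ≤ a) (hb : 2 ≤ b) (hc : 2 ≤ c)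
    (h : x ^ a * y ^ b * z ^ c = 1) :
    ∃ w : FreeGroup α, x ∈ Subgroup.zpowers w ∧ y ∈ Subgroup.zpowers w ∧
      z ∈ Subgroup.zpowers w := by
  lift a to ℕ using by omega
  lift b to ℕ using by omega
  lift c to ℕ using by omega
  norm_cast at ha hb hc
  simp only [zpow_natCast] at h
  have hpow : z⁻¹ ^ c = x ^ a * y ^ b := by
    rw [inv_pow]
    exact (eq_inv_of_mul_eq_one_left h).symm
  have hxy := FreeGroup.commute_of_pow_eq_pow_mul_pow (inv_ne_one.mpr hz) ha hb hc hpow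
  have hxz : Commute x z⁻¹ := FreeGroup.commute_of_commute_pow (c := c) (by omega) <| by
    rw [hpow]
    exact ((Commute.refl x).pow_right a).mul_right (hxy.pow_right b)
  have hyz : Commute y z⁻¹ := FreeGroup.commute_of_commute_pow (c := c) (by omega) <| by
    rw [hpow]
    exact (hxy.symm.pow_right a).mul_right ((Commute.refl y).pow_right b)
  exact FreeGroup.exists_mem_zpowers_of_commute hxy (Commute.inv_right_iff.mp hxz)
    (Commute.inv_right_iff.mp hyz)
end
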